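/- If p + q = n − 1, then for each i ≥ 0 the multiplication map by g^{2i+1} from D^{p−i,q−i} to D^{p+i+1,q+i+1} is a linear isomorphism. -/

import Mathlib

open scoped BigOperators

namespace DoubleForm

/-- The model Euclidean vector space of dimension `n` (with the standard inner product). -/
abbrev V (n : ℕ) := Fin n → ℝ

/-- The standard orthonormal basis of `V n`. -/
def E (n : ℕ) (j : Fin n) : V n := fun k => if k = j then 1 else 0

/-- Raw double forms of bidegree `(p,q)`: real valued functions of `p` vectors and `q` vectors.
Genuine double forms are singled out by `IsDF`. -/
abbrev DF (n p q : ℕ) := (Fin p → V n) → (Fin q → V n) → ℝ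

/-- `ω` is a genuine double form: multilinear and alternating in the first `p`
and in the last `q` arguments. -/
def IsDF {n p q : ℕ} (ω : DF n p q) : Prop :=
  ∃ F : AlternatingMap ℝ (V n) (AlternatingMap ℝ (V n) ℝ (Fin q)) (Fin p),
    ∀ x y, ω x y = F x y

/-- Transport of double forms along equalities of the degrees. -/
def DFcast {n p q p' q' : ℕ} (h1 : p = p') (h2 : q = q') (ω : DF n p q) : DF n p' q' :=
  fun x y => ω (fun i => x (Fin.cast h1 i)) (fun j => y (Fin.cast h2 j))

/-- The product of double forms (Kulkarni's product). -/
noncomputable def mul {n p q r s : ℕ} (ω : DF n p q) (η : DF n r s) :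
    DF n (p + r) (q + s) := fun x y =>
  (((p.factorial * r.factorial * q.factorial * s.factorial : ℕ) : ℝ))⁻¹ *
    ∑ σ : Equiv.Perm (Fin (p + r)), ∑ ρ : Equiv.Perm (Fin (q + s)),
      ((Equiv.Perm.sign σ : ℤ) : ℝ) * ((Equiv.Perm.sign ρ : ℤ) : ℝ) *
        ω (fun i => x (σ (Fin.castAdd r i))) (fun j => y (ρ (Fin.castAdd s j))) *
        η (fun i => x (σ (Fin.natAdd p i))) (fun j => y (ρ (Fin.natAdd q j)))

/-- The metric `g` as a double form of bidegree `(1,1)`. -/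
noncomputable def gm (n : ℕ) : DF n 1 1 := fun x y => ∑ j : Fin n, x 0 j * y 0 j

/-- Powers `g^l` of the metric in the algebra of double forms. -/
noncomputable def gpow (n : ℕ) : (l : ℕ) → DF n l l
  | 0 => fun _ _ => 1
  | l + 1 => mul (gpow n l) (gm n)

/-- The contraction map `c : D^{p,q} → D^{p-1,q-1}` (zero if `p = 0` or `q = 0`). -/
noncomputable def contr {n : ℕ} : ∀ {p q : ℕ}, DF n p q → DF n (p - 1) (q - 1)
  | p + 1, q + 1, ω => fun x y =>
      ∑ j : Fin n, ω (Fin.cons (E n j) x) (Fin.cons (E n j) y)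
  | 0, _, _ => 0
  | _ + 1, 0, _ => 0

/-- Iterated contraction `c^k`. -/
noncomputable def ck {n : ℕ} : ∀ (k : ℕ) {p q : ℕ}, DF n p q → DF n (p - k) (q - k)
  | 0, _, _, ω => ω
  | k + 1, _, _, ω => contr (ck k ω)

/-- The natural inner product on `D^{p,q}`. -/
noncomputable def innerDF {n p q : ℕ} (ω θ : DF n p q) : ℝ :=
  (((p.factorial * q.factorial : ℕ) : ℝ))⁻¹ *
    ∑ f : Fin p → Fin n, ∑ g : Fin q → Fin n,
      ω (fun i => E n (f i)) (fun j => E n (g j)) *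
        θ (fun i => E n (f i)) (fun j => E n (g j))

/-- The natural inner product extended to all bidegrees: distinct bidegrees are orthogonal. -/
noncomputable def innerDF2 {n p q r s : ℕ} (ω : DF n p q) (θ : DF n r s) : ℝ :=
  if h : p = r ∧ q = s then innerDF (DFcast h.1 h.2 ω) θ else 0

/-- Determinant of the `n × n` matrix whose first `p` rows are the basis vectors `E (f i)`
and whose remaining rows are the vectors `x`. -/
noncomputable def rowsDet {n : ℕ} (p : ℕ) (f : Fin p → Fin n) (x : Fin (n - p) → V n) : ℝ :=
  Matrix.det (Matrix.of fun i k : Fin n =>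
    if h : (i : ℕ) < p then E n (f ⟨(i : ℕ), h⟩) k
    else x ⟨(i : ℕ) - p, by have := i.isLt; omega⟩ k)

/-- The Hodge star operator extended to double forms, `D^{p,q} → D^{n-p,n-q}`. -/
noncomputable def hstar {n p q : ℕ} (ω : DF n p q) : DF n (n - p) (n - q) := fun x y =>
  (((p.factorial * q.factorial : ℕ) : ℝ))⁻¹ *
    ∑ f : Fin p → Fin n, ∑ g : Fin q → Fin n,
      ω (fun i => E n (f i)) (fun j => E n (g j)) * rowsDet p f x * rowsDet q g y

/-- The first Bianchi sum `B : D^{p,q} → D^{p+1,q-1}` (zero if `q = 0`). -/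
noncomputable def bianchi {n : ℕ} : ∀ {p q : ℕ}, DF n p q → DF n (p + 1) (q - 1)
  | p, q + 1, ω => fun x y =>
      ∑ j : Fin (p + 1), (-1 : ℝ) ^ ((j : ℕ) + 1) *
        ω (fun i => x (j.succAbove i)) (Fin.cons (x j) y)
  | _, 0, _ => 0

/-- Symmetric double forms of bidegree `(p,p)`. -/
def IsSymm {n p : ℕ} (ω : DF n p p) : Prop := ∀ x y, ω x y = ω y x

/-- The total (bigraded) space of double forms. -/
abbrev DT (n : ℕ) := ∀ p q : ℕ, DF n p q

/-- Embedding of the component `D^{p,q}` into the total space. -/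
noncomputable def emb {n : ℕ} (p q : ℕ) (ω : DF n p q) : DT n := fun p' q' =>
  if h : p = p' ∧ q = q' then DFcast h.1 h.2 ω else 0

/-- Averaging over a subgroup: composing with permutations induced from `β`, `β'` does not change
a signed sum over all permutations, up to the number of such permutations. -/
theorem sum_sign_mul_comp {α α' β β' : Type*} [Fintype α] [DecidableEq α] [Fintype α']
    [DecidableEq α'] [Fintype β] [DecidableEq β] [Fintype β'] [DecidableEq β']
    (e : Equiv.Perm β → Equiv.Perm α) (he : ∀ τ, Equiv.Perm.sign (e τ) = Equiv.Perm.sign τ)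
    (e' : Equiv.Perm β' → Equiv.Perm α') (he' : ∀ τ, Equiv.Perm.sign (e' τ) = Equiv.Perm.sign τ)
    (f : Equiv.Perm α → Equiv.Perm α' → ℝ) :
    ∑ σ, ∑ ρ, ((Equiv.Perm.sign σ : ℤ) : ℝ) * ((Equiv.Perm.sign ρ : ℤ) : ℝ) *
        (∑ τ, ∑ κ, ((Equiv.Perm.sign τ : ℤ) : ℝ) * ((Equiv.Perm.sign κ : ℤ) : ℝ) *
          f (σ * e τ) (ρ * e' κ)) =
      ((Fintype.card β).factorial * (Fintype.card β').factorial : ℝ) *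
        ∑ σ, ∑ ρ, ((Equiv.Perm.sign σ : ℤ) : ℝ) * ((Equiv.Perm.sign ρ : ℤ) : ℝ) * f σ ρ := by
  have key : ∀ (τ : Equiv.Perm β) (κ : Equiv.Perm β'),
      ∑ σ, ∑ ρ, ((Equiv.Perm.sign σ : ℤ) : ℝ) * ((Equiv.Perm.sign ρ : ℤ) : ℝ) *
        (((Equiv.Perm.sign τ : ℤ) : ℝ) * ((Equiv.Perm.sign κ : ℤ) : ℝ) *
          f (σ * e τ) (ρ * e' κ)) =
      ∑ σ, ∑ ρ, ((Equiv.Perm.sign σ : ℤ) : ℝ) * ((Equiv.Perm.sign ρ : ℤ) : ℝ) * f σ ρ := by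
    intro τ κ
    refine Fintype.sum_equiv (Equiv.mulRight (e τ)) _ _ fun σ => ?_
    refine Fintype.sum_equiv (Equiv.mulRight (e' κ)) _ _ fun ρ => ?_
    simp only [Equiv.coe_mulRight, Equiv.Perm.sign_mul, he, he', Units.val_mul, Int.cast_mul]
    ring
  calc _ = ∑ τ, ∑ κ, ∑ σ, ∑ ρ, ((Equiv.Perm.sign σ : ℤ) : ℝ) * ((Equiv.Perm.sign ρ : ℤ) : ℝ) *
        (((Equiv.Perm.sign τ : ℤ) : ℝ) * ((Equiv.Perm.sign κ : ℤ) : ℝ) *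
          f (σ * e τ) (ρ * e' κ)) := by
        simp only [Finset.mul_sum]
        refine (Finset.sum_congr rfl fun σ _ => Finset.sum_comm).trans <|
          Finset.sum_comm.trans <| Finset.sum_congr rfl fun τ _ => ?_
        exact (Finset.sum_congr rfl fun σ _ => Finset.sum_comm).trans Finset.sum_comm
    _ = _ := by
        simp only [key, Finset.sum_const, Finset.card_univ, Fintype.card_perm, nsmul_eq_mul]
        ring

/-- A permutation of the first `a` indices, extended by the identity. -/
def permLeft (a b : ℕ) (τ : Equiv.Perm (Fin a)) : Equiv.Perm (Fin (a + b)) :=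
  finSumFinEquiv.permCongr (Equiv.Perm.sumCongr τ 1)

/-- A permutation of the last `b` indices, extended by the identity. -/
def permRight (a b : ℕ) (τ : Equiv.Perm (Fin b)) : Equiv.Perm (Fin (a + b)) :=
  finSumFinEquiv.permCongr (Equiv.Perm.sumCongr 1 τ)

theorem sign_permLeft (a b : ℕ) (τ : Equiv.Perm (Fin a)) :
    Equiv.Perm.sign (permLeft a b τ) = Equiv.Perm.sign τ := by
  simp [permLeft, Equiv.Perm.sign_permCongr]

theorem sign_permRight (a b : ℕ) (τ : Equiv.Perm (Fin b)) :
    Equiv.Perm.sign (permRight a b τ) = Equiv.Perm.sign τ := by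
  simp [permRight, Equiv.Perm.sign_permCongr]

@[simp] theorem permLeft_castAdd (a b : ℕ) (τ : Equiv.Perm (Fin a)) (i : Fin a) :
    permLeft a b τ (Fin.castAdd b i) = Fin.castAdd b (τ i) := by
  simp [permLeft, Equiv.permCongr_apply]

@[simp] theorem permLeft_natAdd (a b : ℕ) (τ : Equiv.Perm (Fin a)) (i : Fin b) :
    permLeft a b τ (Fin.natAdd a i) = Fin.natAdd a i := by
  simp [permLeft, Equiv.permCongr_apply]

@[simp] theorem permRight_castAdd (a b : ℕ) (τ : Equiv.Perm (Fin b)) (i : Fin a) :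
    permRight a b τ (Fin.castAdd b i) = Fin.castAdd b i := by
  simp [permRight, Equiv.permCongr_apply]

@[simp] theorem permRight_natAdd (a b : ℕ) (τ : Equiv.Perm (Fin b)) (i : Fin b) :
    permRight a b τ (Fin.natAdd a i) = Fin.natAdd a (τ i) := by
  simp [permRight, Equiv.permCongr_apply]

/-- The product of three double forms, with the arguments distributed along given index maps. -/
noncomputable def mulThree {n p q r s t u m k : ℕ} (a : DF n p q) (b : DF n r s) (c : DF n t u)
    (e₁ : Fin p → Fin m) (e₂ : Fin r → Fin m) (e₃ : Fin t → Fin m)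
    (d₁ : Fin q → Fin k) (d₂ : Fin s → Fin k) (d₃ : Fin u → Fin k) : DF n m k := fun x y =>
  ((p.factorial * r.factorial * t.factorial * (q.factorial * s.factorial * u.factorial) : ℝ))⁻¹ *
    ∑ σ : Equiv.Perm (Fin m), ∑ ρ : Equiv.Perm (Fin k),
      ((Equiv.Perm.sign σ : ℤ) : ℝ) * ((Equiv.Perm.sign ρ : ℤ) : ℝ) *
        (a (fun i => x (σ (e₁ i))) (fun j => y (ρ (d₁ j))) *
          b (fun i => x (σ (e₂ i))) (fun j => y (ρ (d₂ j))) *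
            c (fun i => x (σ (e₃ i))) (fun j => y (ρ (d₃ j))))

theorem mul_mul_eq_mulThree_left {n p q r s t u : ℕ} (a : DF n p q) (b : DF n r s)
    (c : DF n t u) :
    mul (mul a b) c = mulThree a b c
      (fun i => Fin.castAdd t (Fin.castAdd r i)) (fun i => Fin.castAdd t (Fin.natAdd p i))
      (fun i => Fin.natAdd (p + r) i)
      (fun i => Fin.castAdd u (Fin.castAdd s i)) (fun i => Fin.castAdd u (Fin.natAdd q i))
      (fun i => Fin.natAdd (q + s) i) := by
  funext x y
  have h := sum_sign_mul_comp (permLeft (p + r) t) (sign_permLeft _ _)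
    (permLeft (q + s) u) (sign_permLeft _ _) (fun σ ρ =>
      a (fun i => x (σ (Fin.castAdd t (Fin.castAdd r i))))
          (fun j => y (ρ (Fin.castAdd u (Fin.castAdd s j)))) *
        b (fun i => x (σ (Fin.castAdd t (Fin.natAdd p i))))
          (fun j => y (ρ (Fin.castAdd u (Fin.natAdd q j)))) *
          c (fun i => x (σ (Fin.natAdd (p + r) i))) (fun j => y (ρ (Fin.natAdd (q + s) j))))
  simp only [Equiv.Perm.mul_apply, permLeft_castAdd, permLeft_natAdd, Fintype.card_fin] at h
  rw [mulThree]
  have h' := (eq_inv_mul_iff_mul_eq₀ (by positivity)).2 h.symm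
  rw [h', mul]
  simp only [mul, Finset.mul_sum, Finset.sum_mul]
  refine Finset.sum_congr rfl fun σ _ => Finset.sum_congr rfl fun ρ _ =>
    Finset.sum_congr rfl fun τ _ => Finset.sum_congr rfl fun κ _ => ?_
  push_cast [mul_inv]
  ring

theorem mul_mul_eq_mulThree_right {n p q r s t u : ℕ} (a : DF n p q) (b : DF n r s)
    (c : DF n t u) :
    mul a (mul b c) = mulThree a b c
      (fun i => Fin.castAdd (r + t) i) (fun i => Fin.natAdd p (Fin.castAdd t i))
      (fun i => Fin.natAdd p (Fin.natAdd r i))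
      (fun i => Fin.castAdd (s + u) i) (fun i => Fin.natAdd q (Fin.castAdd u i))
      (fun i => Fin.natAdd q (Fin.natAdd s i)) := by
  funext x y
  have h := sum_sign_mul_comp (permRight p (r + t)) (sign_permRight _ _)
    (permRight q (s + u)) (sign_permRight _ _) (fun σ ρ =>
      a (fun i => x (σ (Fin.castAdd (r + t) i))) (fun j => y (ρ (Fin.castAdd (s + u) j))) *
        b (fun i => x (σ (Fin.natAdd p (Fin.castAdd t i))))
          (fun j => y (ρ (Fin.natAdd q (Fin.castAdd u j)))) *
          c (fun i => x (σ (Fin.natAdd p (Fin.natAdd r i))))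
            (fun j => y (ρ (Fin.natAdd q (Fin.natAdd s j)))))
  simp only [Equiv.Perm.mul_apply, permRight_castAdd, permRight_natAdd, Fintype.card_fin] at h
  rw [mulThree]
  have h' := (eq_inv_mul_iff_mul_eq₀ (by positivity)).2 h.symm
  rw [h', mul]
  simp only [mul, Finset.mul_sum]
  refine Finset.sum_congr rfl fun σ _ => Finset.sum_congr rfl fun ρ _ =>
    Finset.sum_congr rfl fun τ _ => Finset.sum_congr rfl fun κ _ => ?_
  push_cast [mul_inv]
  ring

theorem DFcast_mulThree {n p q r s t u m k m' k' : ℕ} (hm : m = m') (hk : k = k')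
    (a : DF n p q) (b : DF n r s) (c : DF n t u)
    (e₁ : Fin p → Fin m) (e₂ : Fin r → Fin m) (e₃ : Fin t → Fin m)
    (d₁ : Fin q → Fin k) (d₂ : Fin s → Fin k) (d₃ : Fin u → Fin k) :
    DFcast hm hk (mulThree a b c e₁ e₂ e₃ d₁ d₂ d₃) =
      mulThree a b c (fun i => Fin.cast hm (e₁ i)) (fun i => Fin.cast hm (e₂ i))
        (fun i => Fin.cast hm (e₃ i)) (fun i => Fin.cast hk (d₁ i)) (fun i => Fin.cast hk (d₂ i))
        (fun i => Fin.cast hk (d₃ i)) := by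
  subst hm hk
  rfl

/-- The product of double forms is associative. -/
theorem mul_assoc_cast {n p q r s t u : ℕ} (a : DF n p q) (b : DF n r s) (c : DF n t u) :
    DFcast (Nat.add_assoc p r t) (Nat.add_assoc q s u) (mul (mul a b) c) = mul a (mul b c) := by
  rw [mul_mul_eq_mulThree_left, mul_mul_eq_mulThree_right, DFcast_mulThree]
  congr 1 <;> funext i <;> ext <;> simp [Nat.add_assoc]

theorem sum_perm_succ {p : ℕ} {M : Type*} (x : Fin (p + 1) → M)
    (f : Fin (p + 1) → (Fin p → M) → ℝ)
    (hf : ∀ a v (τ : Equiv.Perm (Fin p)),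
      f a (fun i => v (τ i)) = ((Equiv.Perm.sign τ : ℤ) : ℝ) * f a v) :
    ∑ σ : Equiv.Perm (Fin (p + 1)), ((Equiv.Perm.sign σ : ℤ) : ℝ) *
        f (σ 0) (fun i => x (σ i.succ)) =
      p.factorial * ∑ a : Fin (p + 1), (-1 : ℝ) ^ (a : ℕ) * f a (a.removeNth x) := by
  have hcomp : ∀ a : Fin (p + 1), ∀ τ : Equiv.Perm (Fin p), ∀ i : Fin p,
      (a.cycleRange.symm * Equiv.Perm.decomposeFin.symm (0, τ)) i.succ = a.succAbove (τ i) := by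
    intro a τ i
    simp [Equiv.Perm.mul_apply]
  have hzero : ∀ a : Fin (p + 1), ∀ τ : Equiv.Perm (Fin p),
      (a.cycleRange.symm * Equiv.Perm.decomposeFin.symm (0, τ)) 0 = a := by
    intro a τ
    simp [Equiv.Perm.mul_apply]
  have hbij : Function.Bijective (fun z : Fin (p + 1) × Equiv.Perm (Fin p) =>
      z.1.cycleRange.symm * Equiv.Perm.decomposeFin.symm (0, z.2)) := by
    rw [Fintype.bijective_iff_injective_and_card]
    refine ⟨?_, by simp [Fintype.card_perm, Nat.factorial_succ]⟩
    rintro ⟨a, τ⟩ ⟨b, κ⟩ h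
    have hab : a = b := by rw [← hzero a τ, ← hzero b κ]; exact congrArg (fun σ => σ 0) h
    subst hab
    refine Prod.ext rfl (Equiv.ext fun i => a.succAbove_right_injective ?_)
    rw [← hcomp, ← hcomp]
    exact congrArg (fun σ => σ i.succ) h
  rw [← Fintype.sum_equiv (Equiv.ofBijective _ hbij) _ _ (fun _ => rfl), Fintype.sum_prod_type,
    Finset.mul_sum]
  refine Finset.sum_congr rfl fun a _ => ?_
  have hterm : ∀ τ : Equiv.Perm (Fin p), ((Equiv.Perm.sign
      (a.cycleRange.symm * Equiv.Perm.decomposeFin.symm (0, τ)) : ℤ) : ℝ) *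
      f a (fun i => x (a.succAbove (τ i))) = (-1 : ℝ) ^ (a : ℕ) * f a (a.removeNth x) := by
    intro τ
    have hs : ((Equiv.Perm.sign τ : ℤ) : ℝ) * ((Equiv.Perm.sign τ : ℤ) : ℝ) = 1 := by
      rw [← Int.cast_mul, ← Units.val_mul, Int.units_mul_self]; simp
    have hv := hf a (a.removeNth x) τ
    simp only [Fin.removeNth_apply] at hv
    rw [hv, Equiv.Perm.sign_mul, Equiv.Perm.sign_symm, Fin.sign_cycleRange,
      Equiv.Perm.decomposeFin.symm_sign]
    push_cast
    simp only [if_true, Units.val_one, Int.cast_one, one_mul]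
    linear_combination ((-1 : ℝ) ^ (a : ℕ) * f a (a.removeNth x)) * hs
  simp only [Equiv.ofBijective_apply, hcomp, hzero, hterm]
  simp [Fintype.card_perm]

theorem sum_perm_one_add {p : ℕ} {M : Type*} (x : Fin (1 + p) → M)
    (f : M → (Fin p → M) → ℝ)
    (hf : ∀ a v (τ : Equiv.Perm (Fin p)),
      f a (fun i => v (τ i)) = ((Equiv.Perm.sign τ : ℤ) : ℝ) * f a v) :
    ∑ σ : Equiv.Perm (Fin (1 + p)), ((Equiv.Perm.sign σ : ℤ) : ℝ) *
        f (x (σ (Fin.castAdd p 0))) (fun i => x (σ (Fin.natAdd 1 i))) =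
      p.factorial * ∑ a : Fin (p + 1), (-1 : ℝ) ^ (a : ℕ) *
        f (x (Fin.cast (Nat.add_comm p 1) a))
          (a.removeNth fun i => x (Fin.cast (Nat.add_comm p 1) i)) := by
  have gen : ∀ (m : ℕ) (h : p + 1 = m) (x : Fin m → M) (z : Fin m) (e : Fin p → Fin m)
      (_ : z = Fin.cast h 0) (_ : e = fun i => Fin.cast h i.succ),
      ∑ σ : Equiv.Perm (Fin m), ((Equiv.Perm.sign σ : ℤ) : ℝ) *
        f (x (σ z)) (fun i => x (σ (e i))) =
      p.factorial * ∑ a : Fin (p + 1), (-1 : ℝ) ^ (a : ℕ) *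
        f (x (Fin.cast h a)) (a.removeNth fun i => x (Fin.cast h i)) := by
    rintro m rfl x z e rfl rfl
    exact sum_perm_succ x (fun a => f (x a)) fun a => hf (x a)
  refine gen _ (Nat.add_comm p 1) x _ _ ?_ ?_
  · ext; simp
  · funext i; ext; simp [Nat.add_comm]

section Factor

variable {n p : ℕ} {N : Type*} [AddCommGroup N] [Module ℝ N]

/-- Exterior multiplication by the `j`-th coordinate form. -/
noncomputable def wedgeCoord (n p : ℕ) (N : Type*) [AddCommGroup N] [Module ℝ N] (j : Fin n) :
    (V n [⋀^Fin p]→ₗ[ℝ] N) →ₗ[ℝ] (V n [⋀^Fin (p + 1)]→ₗ[ℝ] N) :=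
  AlternatingMap.alternatizeUncurryFinLM ∘ₗ
    LinearMap.smulRightₗ (LinearMap.proj j : V n →ₗ[ℝ] ℝ)

/-- Interior multiplication by the `j`-th basis vector. -/
noncomputable def interiorBasis (n p : ℕ) (N : Type*) [AddCommGroup N] [Module ℝ N] (j : Fin n) :
    (V n [⋀^Fin (p + 1)]→ₗ[ℝ] N) →ₗ[ℝ] (V n [⋀^Fin p]→ₗ[ℝ] N) :=
  LinearMap.applyₗ (E n j) ∘ₗ AlternatingMap.curryLeftLinearMap

theorem wedgeCoord_apply (j : Fin n) (f : V n [⋀^Fin p]→ₗ[ℝ] N) (x : Fin (p + 1) → V n) :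
    wedgeCoord n p N j f x = ∑ a : Fin (p + 1), ((-1 : ℝ) ^ (a : ℕ) * x a j) • f (a.removeNth x) := by
  simp [wedgeCoord, AlternatingMap.alternatizeUncurryFin_apply, mul_smul, ← Int.cast_smul_eq_zsmul ℝ]

theorem interiorBasis_apply (j : Fin n) (f : V n [⋀^Fin (p + 1)]→ₗ[ℝ] N) (x : Fin p → V n) :
    interiorBasis n p N j f x = f (Matrix.vecCons (E n j) x) := rfl

theorem interiorBasis_wedgeCoord_zero (j k : Fin n) (f : V n [⋀^Fin 0]→ₗ[ℝ] N) :
    interiorBasis n 0 N k (wedgeCoord n 0 N j f) = (if j = k then (1 : ℝ) else 0) • f := by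
  ext x
  rw [interiorBasis_apply, wedgeCoord_apply]
  by_cases h : j = k <;> simp [E, h]

theorem interiorBasis_wedgeCoord_succ (j k : Fin n) (f : V n [⋀^Fin (p + 1)]→ₗ[ℝ] N) :
    interiorBasis n (p + 1) N k (wedgeCoord n (p + 1) N j f) =
      (if j = k then (1 : ℝ) else 0) • f - wedgeCoord n p N j (interiorBasis n p N k f) := by
  ext x
  rw [interiorBasis_apply, wedgeCoord_apply, Fin.sum_univ_succ]
  rw [AlternatingMap.sub_apply, AlternatingMap.smul_apply, wedgeCoord_apply, sub_eq_add_neg,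
    ← Finset.sum_neg_distrib]
  simp only [interiorBasis_apply]
  congr 1
  · by_cases h : j = k <;> simp [E, h]
  · refine Finset.sum_congr rfl fun a _ => ?_
    have hr : a.succ.removeNth (Matrix.vecCons (E n k) x) =
        Matrix.vecCons (E n k) (a.removeNth x) := by
      funext i
      refine Fin.cases ?_ (fun i => ?_) i <;> simp [Fin.removeNth_apply]
    rw [hr, ← neg_smul]
    congr 1
    simp [pow_succ]

theorem alternatingMap_sum_apply {ι : Type*} (s : Finset ι) (f : ι → V n [⋀^Fin p]→ₗ[ℝ] N)
    (x : Fin p → V n) : (∑ j ∈ s, f j) x = ∑ j ∈ s, f j x := by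
  classical
  induction s using Finset.induction_on with
  | empty => simp
  | insert a s ha ih => rw [Finset.sum_insert ha, Finset.sum_insert ha, AlternatingMap.add_apply, ih]

theorem sum_wedgeCoord_interiorBasis (f : V n [⋀^Fin (p + 1)]→ₗ[ℝ] N) :
    ∑ j, wedgeCoord n p N j (interiorBasis n p N j f) = ((p : ℝ) + 1) • f := by
  have h : ∀ v : V n, ∑ j, v j • E n j = v := by
    intro v
    funext k
    simp [E]
  ext x
  have h2 := congrArg (fun g => g x) (AlternatingMap.alternatizeUncurryFin_curryLeft f)
  simp only [AlternatingMap.alternatizeUncurryFin_apply] at h2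
  rw [alternatingMap_sum_apply]
  simp only [wedgeCoord_apply]
  rw [Finset.sum_comm]
  refine Eq.trans (Finset.sum_congr rfl fun a _ => ?_) (h2.trans ?_)
  · conv_rhs => rw [← h (x a), map_sum]
    simp only [mul_smul, interiorBasis_apply, map_smul, alternatingMap_sum_apply,
      AlternatingMap.smul_apply, AlternatingMap.curryLeft_apply_apply, ← Finset.smul_sum]
    rw [← Int.cast_smul_eq_zsmul ℝ]
    simp
  · rw [AlternatingMap.smul_apply, AlternatingMap.smul_apply, ← Nat.cast_smul_eq_nsmul ℝ]
    simp

end Factor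

section Lefschetz

variable {M : Type*} [AddCommGroup M] [Module ℝ M]

theorem lowering_raising_pow {L C H : Module.End ℝ M} (hCL : C * L - L * C = H)
    (hHL : ∀ (c : ℝ) (v : M), H v = c • v → H (L v) = (c - 2) • L v)
    {c : ℝ} {v : M} (hv : H v = c • v) (r : ℕ) :
    C ((L ^ (r + 1)) v) = (L ^ (r + 1)) (C v) + ((r + 1 : ℝ) * (c - r)) • (L ^ r) v := by
  have hc : ∀ w, C (L w) = L (C w) + H w := by
    intro w
    simp [← hCL]
  have hw : ∀ r : ℕ, H ((L ^ r) v) = (c - 2 * r) • (L ^ r) v := by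
    intro r
    induction r with
    | zero => simpa using hv
    | succ r ih =>
      rw [pow_succ', Module.End.mul_apply, hHL _ _ ih]
      congr 1
      push_cast
      ring
  induction r with
  | zero => simp [hc, hv]
  | succ r ih =>
    rw [pow_succ' L (r + 1), Module.End.mul_apply, hc, ih, hw, map_add, map_smul,
      Module.End.mul_apply, ← Module.End.mul_apply L (L ^ r), ← pow_succ', add_assoc, ← add_smul]
    congr 2
    push_cast
    ring

/-- The injectivity part of the hard Lefschetz theorem for an `sl₂`-triple. -/
theorem raising_pow_injective {L C H : Module.End ℝ M} (hCL : C * L - L * C = H)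
    (hHL : ∀ (c : ℝ) (v : M), H v = c • v → H (L v) = (c - 2) • L v)
    (hHC : ∀ (c : ℝ) (v : M), H v = c • v → H (C v) = (c + 2) • C v) (m : ℕ) :
    ∀ (c : ℝ) (v : M), H v = c • v → (C ^ m) v = 0 → ∀ r : ℕ, (r : ℝ) ≤ c →
      (L ^ r) v = 0 → v = 0 := by
  induction m with
  | zero => intro c v _ hm _ _ _; simpa using hm
  | succ m ih =>
    intro c v hv hm r
    induction r with
    | zero => intro _ h0; simpa using h0
    | succ r ihr =>
      intro hr h0
      push_cast at hr
      have hCv : C v = 0 := by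
        refine ih (c + 2) (C v) (hHC c v hv) (by rwa [pow_succ, Module.End.mul_apply] at hm)
          (r + 2) (by push_cast; linarith) ?_
        have h1 := lowering_raising_pow hCL hHL hv (r + 1)
        rw [pow_succ' L (r + 1), Module.End.mul_apply, h0] at h1
        simpa [pow_succ' L (r + 1), h0] using h1.symm
      have h1 := lowering_raising_pow hCL hHL hv r
      rw [h0, hCv, map_zero, map_zero, zero_add] at h1
      have hne : (r + 1 : ℝ) * (c - r) ≠ 0 := by
        have : 0 < c - r := by linarith
        positivity
      exact ihr (by linarith) ((smul_eq_zero.1 h1.symm).resolve_left hne)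

end Lefschetz

/-- Double forms as a vector space. -/
abbrev Form (n p q : ℕ) := V n [⋀^Fin p]→ₗ[ℝ] (V n [⋀^Fin q]→ₗ[ℝ] ℝ)

/-- The bigraded space of all families of double forms. -/
abbrev Forms (n : ℕ) := ∀ p q : ℕ, Form n p q

section Operators

variable {n : ℕ}

noncomputable instance (n p q : ℕ) : AddCommGroup (Form n p q) := inferInstance

noncomputable instance (n : ℕ) : AddCommGroup (Forms n) := inferInstance

noncomputable instance (n : ℕ) : Ring (Module.End ℝ (Forms n)) := inferInstance

/-- Exterior multiplication by a coordinate form in the first factor. -/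
noncomputable def wedgeFst (n : ℕ) (j : Fin n) : Module.End ℝ (Forms n) where
  toFun ω
    | 0, _ => 0
    | p + 1, q => wedgeCoord n p _ j (ω p q)
  map_add' ω η := by funext p q; cases p <;> simp
  map_smul' c ω := by funext p q; cases p <;> simp

/-- Exterior multiplication by a coordinate form in the second factor. -/
noncomputable def wedgeSnd (n : ℕ) (j : Fin n) : Module.End ℝ (Forms n) where
  toFun ω
    | _, 0 => 0
    | p, q + 1 => (wedgeCoord n q ℝ j).compAlternatingMap (ω p q)
  map_add' ω η := by funext p q; cases q <;> ext <;> simp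
  map_smul' c ω := by funext p q; cases q <;> ext <;> simp

/-- Interior multiplication by a basis vector in the first factor. -/
noncomputable def interiorFst (n : ℕ) (j : Fin n) : Module.End ℝ (Forms n) where
  toFun ω p q := interiorBasis n p _ j (ω (p + 1) q)
  map_add' ω η := by funext p q; simp
  map_smul' c ω := by funext p q; simp

/-- Interior multiplication by a basis vector in the second factor. -/
noncomputable def interiorSnd (n : ℕ) (j : Fin n) : Module.End ℝ (Forms n) where
  toFun ω p q := (interiorBasis n q ℝ j).compAlternatingMap (ω p (q + 1))
  map_add' ω η := by funext p q; ext; simp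
  map_smul' c ω := by funext p q; ext; simp

/-- Multiplication by the metric. -/
noncomputable def lefschetz (n : ℕ) : Module.End ℝ (Forms n) :=
  ∑ j, wedgeFst n j * wedgeSnd n j

/-- The contraction. -/
noncomputable def contraction (n : ℕ) : Module.End ℝ (Forms n) :=
  ∑ k, interiorFst n k * interiorSnd n k

/-- The weight operator, acting on bidegree `(p, q)` as `n - p - q`. -/
noncomputable def weight (n : ℕ) : Module.End ℝ (Forms n) where
  toFun ω p q := ((n : ℝ) - p - q) • ω p q
  map_add' ω η := by funext p q; simp
  map_smul' c ω := by funext p q; simp [smul_comm c]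

theorem interiorFst_mul_wedgeFst (j k : Fin n) :
    interiorFst n k * wedgeFst n j =
      (if j = k then (1 : ℝ) else 0) • (1 : Module.End ℝ (Forms n)) - wedgeFst n j * interiorFst n k := by
  refine LinearMap.ext fun ω => ?_
  funext p q
  cases p with
  | zero => exact (interiorBasis_wedgeCoord_zero j k (ω 0 q)).trans (sub_zero _).symm
  | succ p => exact interiorBasis_wedgeCoord_succ j k (ω (p + 1) q)

theorem interiorSnd_mul_wedgeSnd (j k : Fin n) :
    interiorSnd n k * wedgeSnd n j =
      (if j = k then (1 : ℝ) else 0) • (1 : Module.End ℝ (Forms n)) - wedgeSnd n j * interiorSnd n k := by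
  refine LinearMap.ext fun ω => ?_
  funext p q
  refine AlternatingMap.ext fun x => ?_
  cases q with
  | zero => exact (interiorBasis_wedgeCoord_zero j k (ω p 0 x)).trans (sub_zero _).symm
  | succ q => exact interiorBasis_wedgeCoord_succ j k (ω p (q + 1) x)

theorem comp_wedgeCoord {p : ℕ} {N N' : Type*} [AddCommGroup N] [Module ℝ N] [AddCommGroup N']
    [Module ℝ N'] (g : N →ₗ[ℝ] N') (j : Fin n) (f : V n [⋀^Fin p]→ₗ[ℝ] N) :
    g.compAlternatingMap (wedgeCoord n p N j f) =
      wedgeCoord n p N' j (g.compAlternatingMap f) := by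
  refine AlternatingMap.ext fun x => ?_
  simp [wedgeCoord_apply]

theorem interiorSnd_mul_wedgeFst (j k : Fin n) :
    interiorSnd n k * wedgeFst n j = wedgeFst n j * interiorSnd n k := by
  refine LinearMap.ext fun ω => ?_
  funext p q
  cases p with
  | zero => exact AlternatingMap.ext fun x => map_zero (interiorBasis n q ℝ k)
  | succ p => exact comp_wedgeCoord _ _ _

theorem wedgeSnd_mul_interiorFst (j k : Fin n) :
    wedgeSnd n j * interiorFst n k = interiorFst n k * wedgeSnd n j := by
  refine LinearMap.ext fun ω => ?_
  funext p q
  cases q with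
  | zero => exact (map_zero (interiorBasis n p _ k)).symm
  | succ q => rfl

theorem sum_wedgeFst_mul_interiorFst (ω : Forms n) (p q : ℕ) :
    (∑ j, wedgeFst n j * interiorFst n j) ω p q = (p : ℝ) • ω p q := by
  rw [LinearMap.sum_apply, Finset.sum_apply, Finset.sum_apply]
  cases p with
  | zero => exact (Finset.sum_eq_zero fun j _ => rfl).trans (by simp)
  | succ p => exact_mod_cast sum_wedgeCoord_interiorBasis (ω (p + 1) q)

theorem sum_wedgeSnd_mul_interiorSnd (ω : Forms n) (p q : ℕ) :
    (∑ j, wedgeSnd n j * interiorSnd n j) ω p q = (q : ℝ) • ω p q := by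
  rw [LinearMap.sum_apply, Finset.sum_apply, Finset.sum_apply]
  refine AlternatingMap.ext fun x => ?_
  rw [alternatingMap_sum_apply]
  cases q with
  | zero => exact (Finset.sum_eq_zero fun j _ => rfl).trans (by simp)
  | succ q => exact_mod_cast sum_wedgeCoord_interiorBasis (ω p (q + 1) x)

theorem contraction_mul_lefschetz_sub :
    contraction n * lefschetz n - lefschetz n * contraction n = weight n := by
  have h1 : contraction n * lefschetz n = ∑ j, ∑ k,
      (interiorFst n k * wedgeFst n j) * (interiorSnd n k * wedgeSnd n j) := by
    rw [contraction, lefschetz, Finset.mul_sum]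
    refine Finset.sum_congr rfl fun j _ => ?_
    rw [Finset.sum_mul]
    refine Finset.sum_congr rfl fun k _ => ?_
    rw [mul_assoc, ← mul_assoc (interiorSnd n k), interiorSnd_mul_wedgeFst]
    simp only [mul_assoc]
  have h2 : lefschetz n * contraction n = ∑ j, ∑ k,
      (wedgeFst n j * interiorFst n k) * (wedgeSnd n j * interiorSnd n k) := by
    rw [contraction, lefschetz, Finset.sum_mul]
    refine Finset.sum_congr rfl fun j _ => ?_
    rw [Finset.mul_sum]
    refine Finset.sum_congr rfl fun k _ => ?_
    rw [mul_assoc, ← mul_assoc (wedgeSnd n j), wedgeSnd_mul_interiorFst]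
    simp only [mul_assoc]
  have h3 : ∀ j k : Fin n,
      (interiorFst n k * wedgeFst n j) * (interiorSnd n k * wedgeSnd n j) -
        (wedgeFst n j * interiorFst n k) * (wedgeSnd n j * interiorSnd n k) =
      if j = k then 1 - wedgeFst n j * interiorFst n j - wedgeSnd n j * interiorSnd n j else 0 := by
    intro j k
    rw [interiorFst_mul_wedgeFst, interiorSnd_mul_wedgeSnd]
    by_cases h : j = k
    · subst h
      simp only [if_true, one_smul]
      noncomm_ring
    · simp [h]
  rw [h1, h2, ← Finset.sum_sub_distrib]
  simp only [← Finset.sum_sub_distrib, h3, Finset.sum_ite_eq, Finset.mem_univ, if_true]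
  rw [Finset.sum_sub_distrib, Finset.sum_sub_distrib]
  refine LinearMap.ext fun ω => ?_
  funext p q
  rw [LinearMap.sub_apply, LinearMap.sub_apply, Pi.sub_apply, Pi.sub_apply, Pi.sub_apply,
    Pi.sub_apply, sum_wedgeFst_mul_interiorFst, sum_wedgeSnd_mul_interiorSnd]
  simp [weight, sub_smul, ← Nat.cast_smul_eq_nsmul ℝ]

theorem lefschetz_succ_succ (ω : Forms n) (p q : ℕ) : lefschetz n ω (p + 1) (q + 1) =
    ∑ j, wedgeCoord n p _ j ((wedgeCoord n q ℝ j).compAlternatingMap (ω p q)) := by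
  rw [lefschetz, LinearMap.sum_apply, Finset.sum_apply, Finset.sum_apply]
  rfl

theorem lefschetz_zero_left (ω : Forms n) (q : ℕ) : lefschetz n ω 0 q = 0 := by
  rw [lefschetz, LinearMap.sum_apply, Finset.sum_apply, Finset.sum_apply]
  exact Finset.sum_eq_zero fun j _ => rfl

theorem lefschetz_zero_right (ω : Forms n) (p : ℕ) : lefschetz n ω p 0 = 0 := by
  rw [lefschetz, LinearMap.sum_apply, Finset.sum_apply, Finset.sum_apply]
  refine Finset.sum_eq_zero fun j _ => ?_
  cases p with
  | zero => rfl
  | succ p => exact map_zero (wedgeCoord n p _ j)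

theorem contraction_apply (ω : Forms n) (p q : ℕ) : contraction n ω p q =
    ∑ j, interiorBasis n p _ j
      ((interiorBasis n q ℝ j).compAlternatingMap (ω (p + 1) (q + 1))) := by
  rw [contraction, LinearMap.sum_apply, Finset.sum_apply, Finset.sum_apply]
  rfl

/-- Multiplication by the metric in a fixed bidegree. -/
noncomputable def lefschetzHom (n p q : ℕ) : Form n p q →ₗ[ℝ] Form n (p + 1) (q + 1) where
  toFun F := ∑ j, wedgeCoord n p _ j ((wedgeCoord n q ℝ j).compAlternatingMap F)
  map_add' F G := by
    rw [← Finset.sum_add_distrib]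
    refine Finset.sum_congr rfl fun j _ => ?_
    rw [← map_add]
    congr 1
    ext; simp
  map_smul' c F := by
    rw [RingHom.id_apply, Finset.smul_sum]
    refine Finset.sum_congr rfl fun j _ => ?_
    rw [← map_smul]
    congr 1
    ext; simp

/-- Iterated multiplication by the metric in a fixed bidegree. -/
noncomputable def lefschetzPow (n p q : ℕ) : ∀ r : ℕ, Form n p q →ₗ[ℝ] Form n (p + r) (q + r)
  | 0 => LinearMap.id
  | r + 1 => lefschetzHom n (p + r) (q + r) ∘ₗ lefschetzPow n p q r

theorem lefschetz_weight {c : ℝ} {ω : Forms n} (h : weight n ω = c • ω) :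
    weight n (lefschetz n ω) = (c - 2) • lefschetz n ω := by
  have hω : ∀ p q : ℕ, ((n : ℝ) - p - q) • ω p q = c • ω p q := fun p q =>
    congrFun (congrFun h p) q
  funext p q
  change ((n : ℝ) - p - q) • lefschetz n ω p q = (c - 2) • lefschetz n ω p q
  rcases p with _ | p
  · simp [lefschetz_zero_left]
  rcases q with _ | q
  · simp [lefschetz_zero_right]
  have hl : lefschetz n ω (p + 1) (q + 1) = lefschetzHom n p q (ω p q) :=
    lefschetz_succ_succ ω p q
  have h1 := congrArg (lefschetzHom n p q) (hω p q)
  rw [map_smul, map_smul] at h1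
  rw [hl, sub_smul c, ← h1, ← sub_smul]
  congr 1
  push_cast
  ring

theorem contraction_weight {c : ℝ} {ω : Forms n} (h : weight n ω = c • ω) :
    weight n (contraction n ω) = (c + 2) • contraction n ω := by
  have hω : ∀ p q : ℕ, ((n : ℝ) - p - q) • ω p q = c • ω p q := fun p q =>
    congrFun (congrFun h p) q
  funext p q
  change ((n : ℝ) - p - q) • contraction n ω p q = (c + 2) • contraction n ω p q
  by_cases hc : (n : ℝ) - p - q = c + 2
  · rw [hc]
  · have hz : ω (p + 1) (q + 1) = 0 := by
      have h1 := hω (p + 1) (q + 1)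
      rw [← sub_eq_zero, ← sub_smul] at h1
      refine (smul_eq_zero.1 h1).resolve_left fun h2 => hc ?_
      push_cast at h2
      linarith
    have : contraction n ω p q = 0 := by
      rw [contraction_apply, hz]
      exact Finset.sum_eq_zero fun j _ => by ext; simp
    rw [this, smul_zero, smul_zero]

theorem contraction_pow_eq_zero (m : ℕ) (ω : Forms n) (h : ∀ p q, m ≤ p → ω p q = 0) :
    (contraction n ^ m) ω = 0 := by
  induction m generalizing ω with
  | zero => funext p q; exact h p q (Nat.zero_le _)
  | succ m ih =>
    rw [pow_succ, Module.End.mul_apply]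
    refine ih _ fun p q hp => ?_
    rw [contraction_apply, h _ _ (by omega)]
    exact Finset.sum_eq_zero fun j _ => by ext; simp

/-- A double form as an element of the bigraded space. -/
noncomputable def homogeneous {p q : ℕ} (F : Form n p q) : Forms n :=
  Pi.single p (Pi.single q F)

@[simp] theorem homogeneous_same {p q : ℕ} (F : Form n p q) : homogeneous F p q = F := by
  simp [homogeneous]

theorem homogeneous_of_ne {p q P Q : ℕ} (F : Form n p q) (h : ¬ (P = p ∧ Q = q)) :
    homogeneous F P Q = 0 := by
  rw [homogeneous]
  by_cases hp : P = p
  · subst hp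
    have hq : Q ≠ q := fun hq => h ⟨rfl, hq⟩
    rw [Pi.single_eq_same, Pi.single_eq_of_ne hq]
  · rw [Pi.single_eq_of_ne hp, Pi.zero_apply]

theorem lefschetz_homogeneous {p q : ℕ} (F : Form n p q) :
    lefschetz n (homogeneous F) = homogeneous (lefschetzHom n p q F) := by
  funext P Q
  rcases P with _ | P
  · rw [lefschetz_zero_left, homogeneous_of_ne _ (by omega)]
  rcases Q with _ | Q
  · rw [lefschetz_zero_right, homogeneous_of_ne _ (by omega)]
  have hl : lefschetz n (homogeneous F) (P + 1) (Q + 1) =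
    lefschetzHom n P Q (homogeneous F P Q) := lefschetz_succ_succ _ P Q
  rw [hl]
  by_cases h : P = p ∧ Q = q
  · obtain ⟨rfl, rfl⟩ := h
    simp
  · rw [homogeneous_of_ne _ h, homogeneous_of_ne _ (by omega), map_zero]

theorem lefschetz_pow_homogeneous {p q : ℕ} (F : Form n p q) (r : ℕ) :
    (lefschetz n ^ r) (homogeneous F) = homogeneous (lefschetzPow n p q r F) := by
  induction r with
  | zero => rfl
  | succ r ih =>
    rw [pow_succ', Module.End.mul_apply, ih, lefschetz_homogeneous]
    rfl

theorem weight_homogeneous {p q : ℕ} (F : Form n p q) :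
    weight n (homogeneous F) = ((n : ℝ) - p - q) • homogeneous F := by
  funext P Q
  change ((n : ℝ) - P - Q) • homogeneous F P Q = ((n : ℝ) - p - q) • homogeneous F P Q
  by_cases h : P = p ∧ Q = q
  · obtain ⟨rfl, rfl⟩ := h
    rfl
  · rw [homogeneous_of_ne _ h, smul_zero, smul_zero]

theorem lefschetzPow_injective {p q r : ℕ} (h : p + q + r ≤ n) :
    Function.Injective (lefschetzPow n p q r) := by
  refine (injective_iff_map_eq_zero _).2 fun F hF => ?_
  have hC : (contraction n ^ (p + 1)) (homogeneous F) = 0 :=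
    contraction_pow_eq_zero _ _ fun P Q hP => homogeneous_of_ne F (by omega)
  have hL : (lefschetz n ^ r) (homogeneous F) = 0 := by
    rw [lefschetz_pow_homogeneous, hF]
    simp [homogeneous]
  have hr : (r : ℝ) ≤ (n : ℝ) - p - q := by
    have : ((p + q + r : ℕ) : ℝ) ≤ n := by exact_mod_cast h
    push_cast at this
    linarith
  have hz : homogeneous F = 0 :=
    raising_pow_injective contraction_mul_lefschetz_sub (fun c v => lefschetz_weight)
      (fun c v => contraction_weight) (p + 1) _ _ (weight_homogeneous F) hC r hr hL
  simpa using congrFun (congrFun hz p) q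

instance (p : ℕ) (N : Type*) [AddCommGroup N] [Module ℝ N] [Module.Finite ℝ N] :
    Module.Finite ℝ (V n [⋀^Fin p]→ₗ[ℝ] N) :=
  Module.Finite.equiv (exteriorPower.alternatingMapLinearEquiv (R := ℝ) (M := V n) (n := p)).symm

theorem finrank_alternatingMap (p : ℕ) (N : Type*) [AddCommGroup N] [Module ℝ N]
    [Module.Finite ℝ N] :
    Module.finrank ℝ (V n [⋀^Fin p]→ₗ[ℝ] N) = n.choose p * Module.finrank ℝ N := by
  rw [(exteriorPower.alternatingMapLinearEquiv (R := ℝ) (M := V n) (n := p)).finrank_eq,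
    Module.finrank_linearMap, exteriorPower.finrank_eq, Module.finrank_fin_fun]

theorem lefschetzPow_surjective {p q r : ℕ} (h : p + q + r = n) :
    Function.Surjective (lefschetzPow n p q r) := by
  have h1 : n.choose (p + r) = n.choose q := Nat.choose_symm_of_eq_add (by omega)
  have h2 : n.choose (q + r) = n.choose p := Nat.choose_symm_of_eq_add (by omega)
  have hfin : Module.finrank ℝ (Form n p q) = Module.finrank ℝ (Form n (p + r) (q + r)) := by
    simp only [finrank_alternatingMap, h1, h2]
    ring
  exact (LinearMap.injective_iff_surjective_of_finrank_eq_finrank hfin).1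
    (lefschetzPow_injective h.le)

end Operators

section Raw

variable {n : ℕ}

/-- The raw double form underlying an element of `Form n p q`. -/
def toDF {p q : ℕ} (F : Form n p q) : DF n p q := fun x y => F x y

theorem lefschetzHom_apply {p q : ℕ} (F : Form n p q) (x : Fin (p + 1) → V n)
    (y : Fin (q + 1) → V n) :
    lefschetzHom n p q F x y = ∑ a : Fin (p + 1), (-1 : ℝ) ^ (a : ℕ) *
      ∑ b : Fin (q + 1), (-1 : ℝ) ^ (b : ℕ) *
        ((∑ j, x a j * y b j) * F (a.removeNth x) (b.removeNth y)) := by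
  simp only [lefschetzHom, LinearMap.coe_mk, AddHom.coe_mk, alternatingMap_sum_apply,
    wedgeCoord_apply, AlternatingMap.smul_apply, LinearMap.compAlternatingMap_apply, smul_eq_mul,
    Finset.mul_sum, Finset.sum_mul]
  refine Finset.sum_comm.trans (Finset.sum_congr rfl fun a _ => ?_)
  refine Finset.sum_comm.trans (Finset.sum_congr rfl fun b _ => ?_)
  refine Finset.sum_congr rfl fun j _ => ?_
  ring

theorem map_perm_fst {p q : ℕ} (F : Form n p q) (v : Fin p → V n) (w : Fin q → V n)
    (τ : Equiv.Perm (Fin p)) :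
    F (fun i => v (τ i)) w = ((Equiv.Perm.sign τ : ℤ) : ℝ) * F v w := by
  have h := congrArg (fun G => G w) (F.map_perm v τ)
  refine h.trans ?_
  simp [Units.smul_def, ← Int.cast_smul_eq_zsmul ℝ]

theorem map_perm_snd {q : ℕ} (F : V n [⋀^Fin q]→ₗ[ℝ] ℝ) (w : Fin q → V n)
    (τ : Equiv.Perm (Fin q)) :
    F (fun i => w (τ i)) = ((Equiv.Perm.sign τ : ℤ) : ℝ) * F w := by
  refine (F.map_perm w τ).trans ?_
  simp [Units.smul_def, ← Int.cast_smul_eq_zsmul ℝ]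

theorem mul_gm_toDF {p q : ℕ} (F : Form n p q) :
    mul (gm n) (toDF F) =
      DFcast (Nat.add_comm p 1) (Nat.add_comm q 1) (toDF (lefschetzHom n p q F)) := by
  funext x y
  have hy : ∀ (u : V n) (v : Fin p → V n), ∑ ρ : Equiv.Perm (Fin (1 + q)),
      ((Equiv.Perm.sign ρ : ℤ) : ℝ) * ((∑ j, u j * y (ρ (Fin.castAdd q 0)) j) *
        F v (fun i => y (ρ (Fin.natAdd 1 i)))) = _ := fun u v =>
    sum_perm_one_add y (fun z w => (∑ j, u j * z j) * F v w) fun z w τ => by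
      rw [map_perm_snd]; ring
  have hx := sum_perm_one_add x (fun u v => ∑ ρ : Equiv.Perm (Fin (1 + q)),
      ((Equiv.Perm.sign ρ : ℤ) : ℝ) * ((∑ j, u j * y (ρ (Fin.castAdd q 0)) j) *
        F v (fun i => y (ρ (Fin.natAdd 1 i))))) fun u v τ => by
      rw [Finset.mul_sum]
      refine Finset.sum_congr rfl fun ρ _ => ?_
      rw [map_perm_fst]; ring
  simp only [hy] at hx
  rw [mul, DFcast, toDF, lefschetzHom_apply]
  have hsum : ∀ S T : ℝ, S = p.factorial * (q.factorial * T) →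
      ((Nat.factorial 1 * p.factorial * Nat.factorial 1 * q.factorial : ℕ) : ℝ)⁻¹ * S = T := by
    rintro S T rfl
    have hp : (p.factorial : ℝ) ≠ 0 := by positivity
    have hq : (q.factorial : ℝ) ≠ 0 := by positivity
    push_cast [Nat.factorial_one]
    field_simp
  refine hsum _ _ (Eq.trans ?_ (hx.trans ?_))
  · refine Finset.sum_congr rfl fun σ _ => ?_
    rw [← hy, Finset.mul_sum]
    refine Finset.sum_congr rfl fun ρ _ => ?_
    simp only [gm, toDF]
    ring
  · simp only [Finset.mul_sum]
    refine Finset.sum_congr rfl fun a _ => Finset.sum_congr rfl fun b _ => ?_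
    ring

theorem mul_DFcast {p q r s r' s' : ℕ} (hr : r = r') (hs : s = s') (a : DF n p q)
    (b : DF n r s) :
    mul a (DFcast hr hs b) =
      DFcast (congrArg (p + ·) hr) (congrArg (q + ·) hs) (mul a b) := by
  subst hr hs
  rfl

theorem DFcast_DFcast {p q p' q' p'' q'' : ℕ} (h1 : p = p') (h2 : q = q') (h1' : p' = p'')
    (h2' : q' = q'') (a : DF n p q) :
    DFcast h1' h2' (DFcast h1 h2 a) = DFcast (h1.trans h1') (h2.trans h2') a := rfl

theorem DFcast_eq_iff {p q p' q' : ℕ} (h1 : p = p') (h2 : q = q') (a : DF n p q)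
    (b : DF n p' q') : DFcast h1 h2 a = b ↔ a = DFcast h1.symm h2.symm b := by
  subst h1 h2
  rfl

theorem emb_DFcast {p q p' q' : ℕ} (h1 : p = p') (h2 : q = q') (a : DF n p q) :
    emb p' q' (DFcast h1 h2 a) = emb p q a := by
  subst h1 h2
  rfl

theorem map_perm_cast_fst {p q m : ℕ} (h : p = m) (F : Form n p q) (x : Fin m → V n)
    (w : Fin q → V n) (σ : Equiv.Perm (Fin m)) :
    F (fun i => x (σ (Fin.cast h i))) w =
      ((Equiv.Perm.sign σ : ℤ) : ℝ) * F (fun i => x (Fin.cast h i)) w := by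
  subst h
  exact map_perm_fst F x w σ

theorem map_perm_cast_snd {q m : ℕ} (h : q = m) (F : V n [⋀^Fin q]→ₗ[ℝ] ℝ) (y : Fin m → V n)
    (ρ : Equiv.Perm (Fin m)) :
    F (fun i => y (ρ (Fin.cast h i))) =
      ((Equiv.Perm.sign ρ : ℤ) : ℝ) * F (fun i => y (Fin.cast h i)) := by
  subst h
  exact map_perm_snd F y ρ

theorem one_mul_DF {p q : ℕ} (F : Form n p q) :
    mul (gpow n 0) (toDF F) = DFcast (Nat.zero_add p).symm (Nat.zero_add q).symm (toDF F) := by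
  funext x y
  have hcast : ∀ {m : ℕ} (i : Fin m), Fin.natAdd 0 i = Fin.cast (Nat.zero_add m).symm i :=
    fun i => Fin.ext (Nat.zero_add _)
  have hsign : ∀ {m : ℕ} (σ : Equiv.Perm (Fin m)),
      ((Equiv.Perm.sign σ : ℤ) : ℝ) * ((Equiv.Perm.sign σ : ℤ) : ℝ) = 1 := fun σ => by
    rw [← Int.cast_mul, ← Units.val_mul, Int.units_mul_self]
    simp
  have hterm : ∀ (σ : Equiv.Perm (Fin (0 + p))) (ρ : Equiv.Perm (Fin (0 + q))),
      ((Equiv.Perm.sign σ : ℤ) : ℝ) * ((Equiv.Perm.sign ρ : ℤ) : ℝ) * 1 *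
        F (fun i => x (σ (Fin.natAdd 0 i))) (fun j => y (ρ (Fin.natAdd 0 j))) =
      F (fun i => x (Fin.cast (Nat.zero_add p).symm i))
        (fun j => y (Fin.cast (Nat.zero_add q).symm j)) := fun σ ρ => by
    simp only [hcast]
    rw [map_perm_cast_fst, map_perm_cast_snd]
    linear_combination (F (fun i => x (Fin.cast (Nat.zero_add p).symm i))
        (fun j => y (Fin.cast (Nat.zero_add q).symm j))) *
      (((Equiv.Perm.sign ρ : ℤ) : ℝ) * ((Equiv.Perm.sign ρ : ℤ) : ℝ) * hsign σ + hsign ρ)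
  simp only [mul, gpow, toDF, DFcast, hterm, Finset.sum_const, Finset.card_univ,
    Fintype.card_perm, Fintype.card_fin, Nat.zero_add, nsmul_eq_mul]
  have hp : (p.factorial : ℝ) ≠ 0 := by positivity
  have hq : (q.factorial : ℝ) ≠ 0 := by positivity
  push_cast [Nat.factorial_zero]
  field_simp

theorem mul_gpow_toDF_eq_lefschetz_pow (r : ℕ) : ∀ {p q P Q : ℕ} (F : Form n p q) (hP : r + p = P)
    (hQ : r + q = Q),
    DFcast hP hQ (mul (gpow n r) (toDF F)) = toDF ((lefschetz n ^ r) (homogeneous F) P Q) := by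
  induction r with
  | zero =>
    intro p q P Q F hP hQ
    obtain rfl : p = P := by omega
    obtain rfl : q = Q := by omega
    rw [one_mul_DF, DFcast_DFcast, pow_zero, Module.End.one_apply, homogeneous_same]
    rfl
  | succ r ih =>
    intro p q P Q F hP hQ
    rw [pow_succ, Module.End.mul_apply, lefschetz_homogeneous,
      ← ih (lefschetzHom n p q F) (by omega) (by omega), gpow, DFcast_eq_iff, DFcast_DFcast]
    have h := mul_assoc_cast (gpow n r) (gm n) (toDF F)
    rw [DFcast_eq_iff] at h
    rw [h, mul_gm_toDF, mul_DFcast, DFcast_DFcast]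

theorem mul_gpow_toDF {p q : ℕ} (r : ℕ) (F : Form n p q) :
    DFcast (Nat.add_comm r p) (Nat.add_comm r q) (mul (gpow n r) (toDF F)) =
      toDF (lefschetzPow n p q r F) := by
  rw [mul_gpow_toDF_eq_lefschetz_pow, lefschetz_pow_homogeneous, homogeneous_same]

theorem isDF_iff {p q : ℕ} {ω : DF n p q} : IsDF ω ↔ ∃ F : Form n p q, ω = toDF F :=
  exists_congr fun _ => ⟨fun h => funext fun x => funext fun y => h x y, fun h x y => by rw [h]; rfl⟩

theorem toDF_eq_zero {p q : ℕ} {F : Form n p q} : toDF F = 0 ↔ F = 0 := by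
  refine ⟨fun h => ?_, fun h => by rw [h]; rfl⟩
  exact AlternatingMap.ext fun x => AlternatingMap.ext fun y => congrFun (congrFun h x) y

end Raw

/-- if `p + q = n − 1`, multiplication by `g^{2i+1}` is a linear isomorphism
from `D^{p−i,q−i}` onto `D^{p+i+1,q+i+1}`. -/
theorem gpow_odd_isomorphism (n p q i : ℕ) (h : p + q + 1 = n) (hip : i ≤ p) (hiq : i ≤ q) :
    (∀ ω : DF n (p - i) (q - i), IsDF ω → mul (gpow n (2 * i + 1)) ω = 0 → ω = 0) ∧
    (∀ θ : DF n (p + i + 1) (q + i + 1), IsDF θ →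
      ∃ ω : DF n (p - i) (q - i), IsDF ω ∧
        emb ((2 * i + 1) + (p - i)) ((2 * i + 1) + (q - i)) (mul (gpow n (2 * i + 1)) ω)
          = emb (p + i + 1) (q + i + 1) θ) := by
  have hn : (p - i) + (q - i) + (2 * i + 1) = n := by omega
  have hP : p + i + 1 = (p - i) + (2 * i + 1) := by omega
  have hQ : q + i + 1 = (q - i) + (2 * i + 1) := by omega
  generalize p + i + 1 = P at *
  generalize q + i + 1 = Q at *
  generalize p - i = a at *
  generalize q - i = b at *
  generalize 2 * i + 1 = r at *
  subst hP hQ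
  constructor
  · intro ω hω h0
    obtain ⟨F, rfl⟩ := isDF_iff.1 hω
    have h1 := mul_gpow_toDF r F
    rw [h0] at h1
    have h2 : lefschetzPow n a b r F = 0 := toDF_eq_zero.1 h1.symm
    rw [(injective_iff_map_eq_zero _).1 (lefschetzPow_injective hn.le) F h2]
    rfl
  · intro θ hθ
    obtain ⟨G, rfl⟩ := isDF_iff.1 hθ
    obtain ⟨F, rfl⟩ := lefschetzPow_surjective hn G
    refine ⟨toDF F, isDF_iff.2 ⟨F, rfl⟩, ?_⟩
    rw [← mul_gpow_toDF, emb_DFcast]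

end DoubleForm
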